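/- Let m ≥ 1. The positive cone {v ∈ ℝ^{1+m} : B_{1,m}(v,v) > 0}, endowed with the subspace topology, has exactly two connected components, namely {v : B_{1,m}(v,v) > 0 and v₀ > 0} and {v : B_{1,m}(v,v) > 0 and v₀ < 0}. -/

import Mathlib

open scoped BigOperators

noncomputable section

/-- The standard symmetric bilinear form of signature `(1, m)` on `ℝ^{1+m}`. -/
def B1m (m : ℕ) (x y : Fin (m + 1) → ℝ) : ℝ :=
  ∑ i : Fin (m + 1), (if (i : ℕ) < 1 then (1 : ℝ) else -1) * x i * y i

/-- The positive cone `{v ∈ ℝ^{1+m} : B(v,v) > 0}`. -/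
def posCone (m : ℕ) : Set (Fin (m + 1) → ℝ) := {v | 0 < B1m m v v}

/-- The component of the positive cone where `v₀ > 0`. -/
def posConePlus (m : ℕ) : Set (Fin (m + 1) → ℝ) := {v | 0 < B1m m v v ∧ 0 < v 0}

/-- The component of the positive cone where `v₀ < 0`. -/
def posConeMinus (m : ℕ) : Set (Fin (m + 1) → ℝ) := {v | 0 < B1m m v v ∧ v 0 < 0}

/-- The form `B1m` on the diagonal, with the time coordinate split off. -/
lemma B1m_self_eq (m : ℕ) (v : Fin (m + 1) → ℝ) :
    B1m m v v = v 0 ^ 2 - ∑ i : Fin m, v i.succ ^ 2 := by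
  simp [B1m, Fin.sum_univ_succ, sq, sub_eq_add_neg]

lemma B1m_neg_neg (m : ℕ) (v : Fin (m + 1) → ℝ) : B1m m (-v) (-v) = B1m m v v := by
  simp [B1m_self_eq]

lemma B1m_smul_single_add_smul_self (m : ℕ) (v : Fin (m + 1) → ℝ) (a b : ℝ) :
    B1m m (a • Pi.single 0 1 + b • v) (a • Pi.single 0 1 + b • v) =
      a ^ 2 + 2 * a * b * v 0 + b ^ 2 * B1m m v v := by
  simp only [B1m_self_eq, Pi.add_apply, Pi.smul_apply, Pi.single_eq_same, smul_eq_mul,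
    Pi.single_eq_of_ne (Fin.succ_ne_zero _), mul_zero, zero_add, mul_pow, ← Finset.mul_sum]
  ring

lemma apply_zero_ne_zero_of_mem_posCone {m : ℕ} {v : Fin (m + 1) → ℝ} (hv : v ∈ posCone m) :
    v 0 ≠ 0 := by
  intro h
  have hv' : 0 < B1m m v v := hv
  rw [B1m_self_eq, h] at hv'
  have : 0 ≤ ∑ i : Fin m, v i.succ ^ 2 := Finset.sum_nonneg fun i _ => sq_nonneg _
  linarith

lemma single_mem_posConePlus (m : ℕ) : Pi.single 0 1 ∈ posConePlus m := by
  simp [posConePlus, B1m_self_eq]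

lemma starConvex_posConePlus (m : ℕ) : StarConvex ℝ (Pi.single 0 1) (posConePlus m) := by
  rintro v ⟨hB, hv⟩ a b ha hb hab
  refine ⟨?_, ?_⟩
  · rw [B1m_smul_single_add_smul_self]
    rcases ha.eq_or_lt with rfl | ha
    · obtain rfl : b = 1 := by linarith
      simpa using hB
    · positivity
  · simp only [Pi.add_apply, Pi.smul_apply, Pi.single_eq_same, smul_eq_mul, mul_one]
    rcases ha.eq_or_lt with rfl | ha
    · obtain rfl : b = 1 := by linarith
      simpa using hv
    · positivity

lemma neg_mem_posConePlus_iff {m : ℕ} {v : Fin (m + 1) → ℝ} :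
    -v ∈ posConePlus m ↔ v ∈ posConeMinus m := by
  simp [posConePlus, posConeMinus, B1m_neg_neg]

lemma isPreconnected_posConePlus (m : ℕ) : IsPreconnected (posConePlus m) :=
  ((starConvex_posConePlus m).isPathConnected
    (single_mem_posConePlus m)).isConnected.isPreconnected

lemma isPreconnected_posConeMinus (m : ℕ) : IsPreconnected (posConeMinus m) := by
  have h : Neg.neg '' posConePlus m = posConeMinus m := by
    ext v
    simp [neg_mem_posConePlus_iff]
  exact h ▸ (isPreconnected_posConePlus m).image _ continuous_neg.continuousOn

/-- If a set `s` is covered by disjoint open sets `u` and `w`, and `s ∩ u` is preconnected, then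
`s ∩ u` is the connected component in `s` of each of its points. -/
lemma connectedComponentIn_eq_inter_of_isOpen {X : Type*} [TopologicalSpace X] {s u w : Set X}
    (hu : IsOpen u) (hw : IsOpen w) (huw : Disjoint u w) (hs : s ⊆ u ∪ w)
    (hsu : IsPreconnected (s ∩ u)) {x : X} (hx : x ∈ s ∩ u) :
    connectedComponentIn s x = s ∩ u := by
  refine (Set.subset_inter (connectedComponentIn_subset s x) ?_).antisymm
    (hsu.subset_connectedComponentIn hx Set.inter_subset_left)
  exact isPreconnected_connectedComponentIn.subset_left_of_subset_union hu hw huw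
    ((connectedComponentIn_subset s x).trans hs) ⟨x, mem_connectedComponentIn hx.1, hx.2⟩

/-- The positive cone of a quadratic form of signature `(1, m)` has
exactly two connected components, namely the parts where `v₀ > 0` and where `v₀ < 0`:
the two parts are disjoint nonempty sets covering the cone, and each one is the
connected component (in the cone) of each of its points. -/
theorem posCone_two_components (m : ℕ) (hm : 1 ≤ m) :
    posCone m = posConePlus m ∪ posConeMinus m ∧
    Disjoint (posConePlus m) (posConeMinus m) ∧
    (posConePlus m).Nonempty ∧
    (posConeMinus m).Nonempty ∧
    (∀ v ∈ posConePlus m, connectedComponentIn (posCone m) v = posConePlus m) ∧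
    (∀ v ∈ posConeMinus m, connectedComponentIn (posCone m) v = posConeMinus m) := by
  have hpos : IsOpen {v : Fin (m + 1) → ℝ | 0 < v 0} :=
    isOpen_lt continuous_const (continuous_apply 0)
  have hneg : IsOpen {v : Fin (m + 1) → ℝ | v 0 < 0} :=
    isOpen_lt (continuous_apply 0) continuous_const
  have hdisj : Disjoint {v : Fin (m + 1) → ℝ | 0 < v 0} {v | v 0 < 0} :=
    Set.disjoint_left.2 fun v (h : 0 < v 0) => h.not_gt
  have hcover : posCone m ⊆ {v | 0 < v 0} ∪ {v | v 0 < 0} := fun _ hv =>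
    (apply_zero_ne_zero_of_mem_posCone hv).symm.lt_or_gt
  refine ⟨?_, hdisj.mono (fun _ h => h.2) (fun _ h => h.2), ⟨_, single_mem_posConePlus m⟩,
    ⟨-Pi.single 0 1, ?_⟩, fun v hv => ?_, fun v hv => ?_⟩
  · exact (Set.inter_eq_left.2 hcover).symm.trans (Set.inter_union_distrib_left _ _ _)
  · rw [← neg_mem_posConePlus_iff, neg_neg]
    exact single_mem_posConePlus m
  · exact connectedComponentIn_eq_inter_of_isOpen hpos hneg hdisj hcover
      (isPreconnected_posConePlus m) hv
  · exact connectedComponentIn_eq_inter_of_isOpen hneg hpos hdisj.symm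
      (hcover.trans (Set.union_comm _ _).subset) (isPreconnected_posConeMinus m) hv

end
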